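/- Let $\lambda > 0$, $0 < \beta < 1$, $t_j \in \mathbb{R}$, $\upsilon \in \mathbb{R}$, and let $f \in W^{1,1}((t_j, t_{j+1}))$ be real-valued. Define $v(t) = \upsilon\, E_{\beta,1}(-\lambda(t-t_j)^{\beta}) + \int_{t_j}^t (t-s)^{\beta-1} E_{\beta,\beta}(-\lambda(t-s)^{\beta}) f(s)\,ds$ for $t \in (t_j, t_{j+1})$. Then for a.e. $t \in (t_j, t_{j+1})$, $v'(t) = (f(t_j) - \lambda\upsilon)\,(t-t_j)^{\beta - 1} E_{\beta,\beta}(-\lambda(t-t_j)^{\beta}) + \int_{t_j}^t (t-s)^{\beta-1} E_{\beta,\beta}(-\lambda(t-s)^{\beta})\, f'(s)\,ds$. -/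

import Mathlib

open MeasureTheory Real intervalIntegral

/-- The two-parameter Mittag–Leffler function `E_{α,β}(z) = ∑ₖ zᵏ/Γ(αk+β)`. -/
noncomputable def mittagLeffler (α β z : ℝ) : ℝ :=
  ∑' k : ℕ, z ^ k / Real.Gamma (α * k + β)

/-- A lower bound for `Γ` showing that it outgrows every exponential. -/
theorem exp_mul_rpow_le_Gamma {M y : ℝ} (hM : 0 < M) (hy : 1 ≤ y) :
    exp (-(M + 1)) * M ^ (y - 1) ≤ Real.Gamma y := by
  have hy0 : 0 < y := by linarith
  have hint := Real.GammaIntegral_convergent hy0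
  have hsub : Set.Ioc M (M + 1) ⊆ Set.Ioi 0 := fun x hx => hM.trans hx.1
  rw [Real.Gamma_eq_integral hy0]
  calc exp (-(M + 1)) * M ^ (y - 1)
      = ∫ _ in Set.Ioc M (M + 1), exp (-(M + 1)) * M ^ (y - 1) := by simp
    _ ≤ ∫ x in Set.Ioc M (M + 1), exp (-x) * x ^ (y - 1) := by
        refine setIntegral_mono_on (integrableOn_const (by simp)) (hint.mono_set hsub)
          measurableSet_Ioc fun x hx => ?_
        have h1 := hx.1.le
        have h2 := hx.2
        have h3 : 0 ≤ y - 1 := by linarith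
        gcongr
    _ ≤ ∫ x in Set.Ioi 0, exp (-x) * x ^ (y - 1) := by
        refine setIntegral_mono_set hint ?_ hsub.eventuallyLE
        filter_upwards [ae_restrict_mem measurableSet_Ioi] with x hx
        have : (0 : ℝ) < x := hx
        positivity

theorem summable_pow_div_Gamma {α β : ℝ} (hα : 0 < α) (z : ℝ) :
    Summable fun k : ℕ => z ^ k / Real.Gamma (α * k + β) := by
  obtain ⟨M, hM, hM0⟩ := (((tendsto_rpow_atTop hα).eventually_gt_atTop |z|).and
    (Filter.eventually_gt_atTop 0)).exists
  have hMα : 0 < M ^ α := rpow_pos_of_pos hM0 α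
  have hgeom : Summable fun k : ℕ => exp (M + 1) * M ^ (1 - β) * (|z| / M ^ α) ^ k :=
    (summable_geometric_of_lt_one (by positivity) ((div_lt_one hMα).2 hM)).mul_left _
  refine summable_of_isBigO_nat hgeom (Asymptotics.IsBigO.of_bound 1 ?_)
  have hlarge : ∀ᶠ k : ℕ in Filter.atTop, 1 ≤ α * k + β :=
    (Filter.tendsto_atTop_add_const_right _ β
      (tendsto_natCast_atTop_atTop.const_mul_atTop hα)).eventually_ge_atTop 1
  filter_upwards [hlarge] with k hk
  have hG := exp_mul_rpow_le_Gamma hM0 hk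
  have hlow : 0 < exp (-(M + 1)) * M ^ (α * k + β - 1) := by positivity
  rw [one_mul, norm_div, norm_pow, Real.norm_eq_abs, Real.norm_of_nonneg (hlow.le.trans hG),
    Real.norm_of_nonneg (by positivity)]
  calc |z| ^ k / Real.Gamma (α * k + β)
      ≤ |z| ^ k / (exp (-(M + 1)) * M ^ (α * k + β - 1)) := by gcongr
    _ = exp (M + 1) * M ^ (1 - β) * (|z| / M ^ α) ^ k := by
        have h1 : M ^ (α * k + β - 1) = (M ^ α) ^ k * (M ^ (1 - β))⁻¹ := by
          rw [← rpow_natCast, ← rpow_mul hM0.le, ← rpow_neg hM0.le, ← rpow_add hM0]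
          congr 1
          ring
        rw [h1, exp_neg, div_pow]
        field_simp

theorem continuous_mittagLeffler {α β : ℝ} (hα : 0 < α) : Continuous (mittagLeffler α β) := by
  rw [continuous_iff_continuousAt]
  intro z
  have hcont : ContinuousOn (mittagLeffler α β) (Metric.closedBall 0 (|z| + 1)) := by
    refine continuousOn_tsum (fun k => by fun_prop)
      (summable_pow_div_Gamma hα (β := β) (|z| + 1)).norm fun k x hx => ?_
    rw [mem_closedBall_zero_iff] at hx
    rw [norm_div, norm_div, norm_pow, norm_pow, Real.norm_of_nonneg (by positivity : 0 ≤ |z| + 1)]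
    gcongr
  refine hcont.continuousAt (Metric.closedBall_mem_nhds_of_mem ?_)
  simp

theorem hasDerivAt_mittagLeffler_one {β : ℝ} (hβ : 0 < β) (z : ℝ) :
    HasDerivAt (mittagLeffler β 1) (mittagLeffler β β z / β) z := by
  have hterm (k : ℕ) (y : ℝ) : (↑(k + 1) * y ^ k) / Real.Gamma (β * ↑(k + 1) + 1)
      = y ^ k / Real.Gamma (β * k + β) / β := by
    have h1 : Real.Gamma (β * ↑(k + 1) + 1) = β * ↑(k + 1) * Real.Gamma (β * k + β) := by
      rw [Real.Gamma_add_one (by positivity)]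
      push_cast
      ring_nf
    have h2 : Real.Gamma (β * k + β) ≠ 0 := (Real.Gamma_pos_of_pos (by positivity)).ne'
    rw [h1]
    field_simp
  have hsum (y : ℝ) : Summable fun k : ℕ => (k * y ^ (k - 1)) / Real.Gamma (β * k + 1) := by
    rw [← summable_nat_add_iff 1]
    simp only [add_tsub_cancel_right, hterm]
    exact (summable_pow_div_Gamma hβ y).div_const β
  have key := hasDerivAt_tsum_of_isPreconnected (t := Metric.ball (0 : ℝ) (|z| + 1))
    (g := fun (k : ℕ) y => y ^ k / Real.Gamma (β * k + 1))
    (g' := fun (k : ℕ) y => (k * y ^ (k - 1)) / Real.Gamma (β * k + 1))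
    (hsum (|z| + 1)).norm Metric.isOpen_ball (convex_ball _ _).isPreconnected
    (fun k y _ => (hasDerivAt_pow k y).div_const _)
    (fun k y hy => by
      rw [mem_ball_zero_iff] at hy
      rw [norm_div, norm_div, norm_mul, norm_mul, norm_pow, norm_pow,
        Real.norm_of_nonneg (by positivity : 0 ≤ |z| + 1)]
      gcongr)
    (y := z) (y₀ := z) (by simp) (summable_pow_div_Gamma hβ z) (by simp)
  refine key.congr_deriv ?_
  rw [(hsum z).tsum_eq_zero_add]
  simp only [add_tsub_cancel_right, hterm]
  simp [mittagLeffler, tsum_div_const]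

theorem hasDerivAt_mittagLeffler_rpow {lam β t : ℝ} (hβ : 0 < β) (ht : 0 < t) :
    HasDerivAt (fun t => mittagLeffler β 1 (-lam * t ^ β))
      (-lam * (t ^ (β - 1) * mittagLeffler β β (-lam * t ^ β))) t := by
  refine ((hasDerivAt_mittagLeffler_one hβ _).comp t
    ((Real.hasDerivAt_rpow_const (p := β) (Or.inl ht.ne')).const_mul (-lam))).congr_deriv ?_
  field_simp

/-- Differentiation of the convolution of an integrable kernel with an absolutely continuous
function. -/
theorem ae_hasDerivAt_integral_kernel_mul {a b : ℝ} {K f f' : ℝ → ℝ} (hab : a < b)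
    (hK : IntervalIntegrable K volume 0 (b - a)) (hf' : IntervalIntegrable f' volume a b)
    (hf : ∀ x ∈ Set.Icc a b, f x = f a + ∫ s in a..x, f' s) :
    ∀ᵐ s, s ∈ Set.Ioo a b → HasDerivAt (fun s => ∫ r in a..s, K (s - r) * f r)
      (f a * K (s - a) + ∫ r in a..s, K (s - r) * f' r) s := by
  set k := (Set.Ioo 0 (b - a)).indicator K with hk
  set g := (Set.Ioo a b).indicator f' with hg
  have hkint : Integrable k := by
    rw [hk, integrable_indicator_iff measurableSet_Ioo,
      ← intervalIntegrable_iff_integrableOn_Ioo_of_le (by linarith)]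
    exact hK
  have hgint : Integrable g := by
    rw [hg, integrable_indicator_iff measurableSet_Ioo,
      ← intervalIntegrable_iff_integrableOn_Ioo_of_le hab.le]
    exact hf'
  have hprod : Integrable (fun p : ℝ × ℝ => k p.2 * g (p.1 - p.2)) (volume.prod volume) :=
    hkint.convolution_integrand (ContinuousLinearMap.mul ℝ ℝ) hgint
  have hconv : Integrable fun u => ∫ x, k x * g (u - x) := hprod.integral_prod_left
  have hconv_eq {u : ℝ} (hu : u ∈ Set.Ioo a b) :
      ∫ x, k x * g (u - x) = ∫ r in a..u, K (u - r) * f' r := by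
    have h1 := integral_comp_sub_left (a := a) (b := u) (fun x => K x * f' (u - x)) u
    simp only [sub_sub_cancel, sub_self] at h1
    rw [h1, integral_of_le (by linarith [hu.1]), integral_Ioc_eq_integral_Ioo,
      ← MeasureTheory.integral_indicator measurableSet_Ioo]
    congr 1 with x
    by_cases hx : x ∈ Set.Ioo 0 (u - a)
    · rw [Set.indicator_of_mem hx, hk, hg,
        Set.indicator_of_mem (show x ∈ Set.Ioo 0 (b - a) from ⟨hx.1, by linarith [hx.2, hu.2]⟩),
        Set.indicator_of_mem
          (show u - x ∈ Set.Ioo a b from ⟨by linarith [hx.2], by linarith [hx.1, hu.2]⟩)]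
    · rw [Set.indicator_of_notMem hx, hk, hg]
      by_cases hx0 : x ∈ Set.Ioo 0 (b - a)
      · rw [Set.indicator_of_notMem (s := Set.Ioo a b), mul_zero]
        exact fun h => hx ⟨hx0.1, by linarith [h.1]⟩
      · rw [Set.indicator_of_notMem hx0, zero_mul]
  have hprim {y : ℝ} (hy : y ∈ Set.Ioo a b) : ∫ r in a..y, g r = f y - f a := by
    rw [hf y ⟨hy.1.le, hy.2.le⟩, add_sub_cancel_left]
    refine integral_congr_ae (Filter.Eventually.of_forall fun r hr => ?_)
    rw [Set.uIoc_of_le hy.1.le] at hr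
    exact Set.indicator_of_mem (show r ∈ Set.Ioo a b from ⟨hr.1, hr.2.trans_lt hy.2⟩) f'
  have hvanish {y z : ℝ} (hy : y ≤ a) (hz : z ≤ a) : ∫ r in y..z, g r = 0 := by
    refine integral_zero_ae (Filter.Eventually.of_forall fun r hr => ?_)
    refine Set.indicator_of_notMem (fun h => ?_) _
    have := hr.2
    have := max_le hy hz
    linarith [h.1]
  have hKshift {s : ℝ} (hs : s ∈ Set.Icc a b) :
      IntervalIntegrable (fun u => K (u - a)) volume a s := by
    exact (hK.comp_sub_right a).mono_set (c := a) (d := s) (by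
      rw [zero_add, sub_add_cancel, Set.uIcc_of_le hs.1, Set.uIcc_of_le hab.le]
      exact Set.Icc_subset_Icc_right hs.2)
  have hint {s : ℝ} (hs : s ∈ Set.Icc a b) :
      IntervalIntegrable (fun u => f a * K (u - a) + ∫ x, k x * g (u - x)) volume a s :=
    ((hKshift hs).const_mul (f a)).add hconv.intervalIntegrable
  have hrep {s : ℝ} (hs : s ∈ Set.Ioo a b) : ∫ r in a..s, K (s - r) * f r
      = ∫ u in a..s, (f a * K (u - a) + ∫ x, k x * g (u - x)) := by
    have hs' := Set.Ioo_subset_Icc_self hs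
    have hsa : 0 ≤ s - a := by linarith [hs.1]
    have hKs : IntervalIntegrable K volume 0 (s - a) := by
      refine hK.mono_set ?_
      rw [Set.uIcc_of_le hsa, Set.uIcc_of_le (by linarith)]
      exact Set.Icc_subset_Icc_right (by linarith [hs.2])
    have hswap : ∫ u in a..s, ∫ x, k x * g (u - x)
        = ∫ x in (0)..(s - a), K x * ∫ r in a..(s - x), g r := by
      rw [intervalIntegral_integral_swap (f := fun u x => k x * g (u - x))
        (hprod.mono_measure (Measure.prod_mono Measure.restrict_le_self le_rfl)),
        integral_of_le hsa, integral_Ioc_eq_integral_Ioo,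
        ← MeasureTheory.integral_indicator measurableSet_Ioo]
      congr 1 with x
      rw [intervalIntegral.integral_const_mul, integral_comp_sub_right]
      by_cases hx0 : x ∈ Set.Ioo 0 (b - a)
      · rw [← integral_add_adjacent_intervals (b := a) hgint.intervalIntegrable
          hgint.intervalIntegrable, hvanish (by linarith [hx0.1]) le_rfl, zero_add, hk,
          Set.indicator_of_mem hx0]
        by_cases hx : x ∈ Set.Ioo 0 (s - a)
        · rw [Set.indicator_of_mem hx]
        · rw [Set.indicator_of_notMem hx, hvanish le_rfl, mul_zero]
          by_contra! h
          exact hx ⟨hx0.1, by linarith⟩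
      · rw [hk, Set.indicator_of_notMem hx0, zero_mul, Set.indicator_of_notMem]
        exact fun h => hx0 ⟨h.1, by linarith [h.2, hs.2]⟩
    have hcont : Continuous fun x => ∫ r in a..(s - x), g r :=
      (continuous_primitive (fun _ _ => hgint.intervalIntegrable) a).comp (by fun_prop)
    have h1 := integral_comp_sub_left (a := a) (b := s) (fun x => K x * f (s - x)) s
    simp only [sub_sub_cancel, sub_self] at h1
    rw [integral_add ((hKshift hs').const_mul (f a)) hconv.intervalIntegrable, hswap,
      intervalIntegral.integral_const_mul, integral_comp_sub_right, sub_self,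
      ← intervalIntegral.integral_const_mul, ← integral_add (hKs.const_mul _)
      (hKs.mul_continuousOn hcont.continuousOn), h1]
    rw [integral_of_le hsa, integral_of_le hsa, integral_Ioc_eq_integral_Ioo,
      integral_Ioc_eq_integral_Ioo]
    refine setIntegral_congr_fun measurableSet_Ioo fun x hx => ?_
    rw [hprim ⟨by linarith [hx.2], by linarith [hx.1, hs.2]⟩]
    ring
  filter_upwards [(hint (Set.right_mem_Icc.2 hab.le)).ae_hasDerivAt_integral] with s hderiv hs
  have h := hderiv (by rw [Set.uIcc_of_le hab.le]; exact Set.Ioo_subset_Icc_self hs) a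
    Set.left_mem_uIcc
  rw [hconv_eq hs] at h
  refine h.congr_of_eventuallyEq ?_
  filter_upwards [isOpen_Ioo.mem_nhds hs] with u hu using hrep hu

/-- Derivative of the Mittag–Leffler representation of the solution of the
constant-order fractional relaxation problem. -/
theorem mittagLeffler_solution_deriv
    (lam β tj tj1 υ : ℝ) (hlam : 0 < lam) (hβ0 : 0 < β) (hβ1 : β < 1) (ht : tj < tj1)
    (f f' : ℝ → ℝ)
    (hf' : IntervalIntegrable f' volume tj tj1)
    (hf : ∀ x ∈ Set.Icc tj tj1, f x = f tj + ∫ s in tj..x, f' s)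
    (v : ℝ → ℝ)
    (hv : ∀ s ∈ Set.Ioo tj tj1,
      v s = υ * mittagLeffler β 1 (-lam * (s - tj) ^ β)
        + ∫ r in tj..s, (s - r) ^ (β - 1)
            * mittagLeffler β β (-lam * (s - r) ^ β) * f r) :
    ∀ᵐ s ∂(volume.restrict (Set.Ioo tj tj1)),
      HasDerivAt v
        ((f tj - lam * υ) * (s - tj) ^ (β - 1)
            * mittagLeffler β β (-lam * (s - tj) ^ β)
          + ∫ r in tj..s, (s - r) ^ (β - 1)
              * mittagLeffler β β (-lam * (s - r) ^ β) * f' r) s := by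
  have hK : IntervalIntegrable (fun x => x ^ (β - 1) * mittagLeffler β β (-lam * x ^ β))
      volume 0 (tj1 - tj) := by
    refine (intervalIntegrable_rpow' (by linarith)).mul_continuousOn (Continuous.continuousOn ?_)
    exact (continuous_mittagLeffler hβ0).comp
      (continuous_const.mul (Real.continuous_rpow_const hβ0.le))
  rw [ae_restrict_iff' measurableSet_Ioo]
  filter_upwards [ae_hasDerivAt_integral_kernel_mul ht hK hf' hf] with s hconv hs
  have hE := ((hasDerivAt_mittagLeffler_rpow (lam := lam) hβ0 (sub_pos.2 hs.1)).comp s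
    ((hasDerivAt_id s).sub_const tj)).const_mul υ
  refine ((hE.add (hconv hs)).congr_of_eventuallyEq ?_).congr_deriv (by ring)
  filter_upwards [isOpen_Ioo.mem_nhds hs] with u hu using hv u hu
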